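/- Existence of optimal couplings for the L⁰-distortion distance: Let (M, τ, m) and (M', τ', m') be normalized bounded Lorentzian metric measure spaces (with M, M' Polish). Then there exists a coupling π of m and m' attaining the infimum in the definition of LΔ₀(M, M'), and moreover π⊗π({(x,x',y,y') : |τ(x,y) − τ'(x',y')| > LΔ₀(M, M')}) ≤ LΔ₀(M, M'). -/

import Mathlib

open MeasureTheory

/-- The defining properties of a bounded Lorentzian metric space `(M, τ)` with
respect to a fixed topology on `M`: `τ` is nonnegative, satisfies the reverse
triangle inequality, is continuous, has compact superlevel sets, and
distinguishes points. -/
structure IsBLMS {M : Type*} [TopologicalSpace M] (tau : M → M → ℝ) : Prop where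
  nonneg : ∀ x y, 0 ≤ tau x y
  rev_triangle : ∀ x y z, 0 < tau x y → 0 < tau y z → tau x y + tau y z ≤ tau x z
  continuous : Continuous fun p : M × M => tau p.1 p.2
  compact_superlevel : ∀ ε : ℝ, 0 < ε → IsCompact {p : M × M | ε ≤ tau p.1 p.2}
  point_distinction : ∀ x y : M, x ≠ y → ∃ z, tau x z ≠ tau y z ∨ tau z x ≠ tau z y

/-- A coupling of two measures: a measure on the product whose marginals are the
given measures. -/
def IsCoupling {M M' : Type*} [MeasurableSpace M] [MeasurableSpace M']
    (π : MeasureTheory.Measure (M × M')) (m : MeasureTheory.Measure M)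
    (m' : MeasureTheory.Measure M') : Prop :=
  π.map Prod.fst = m ∧ π.map Prod.snd = m'

/-- The set of admissible distortion thresholds of a fixed coupling `π`:
`{ε > 0 : π⊗π(|τ(x,y) − τ'(x',y')| > ε) ≤ ε}`. -/
noncomputable def distortionThresholds {M M' : Type*} [MeasurableSpace M] [MeasurableSpace M']
    (tau : M → M → ℝ) (tau' : M' → M' → ℝ)
    (π : MeasureTheory.Measure (M × M')) : Set ℝ :=
  {ε : ℝ | 0 < ε ∧
    (π.prod π) {q : (M × M') × (M × M') |
      ε < |tau q.1.1 q.2.1 - tau' q.1.2 q.2.2|} ≤ ENNReal.ofReal ε}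

/-- The (L⁰-)distortion distance `LΔ₀`: the infimum over all couplings `π` of
`m` and `m'` of the infimum of the admissible distortion thresholds of `π`. -/
noncomputable def LDelta0 {M M' : Type*} [MeasurableSpace M] [MeasurableSpace M']
    (tau : M → M → ℝ) (tau' : M' → M' → ℝ)
    (m : MeasureTheory.Measure M) (m' : MeasureTheory.Measure M') : ℝ :=
  sInf {ε : ℝ | ∃ π : MeasureTheory.Measure (M × M'), IsCoupling π m m' ∧
    ε ∈ distortionThresholds tau tau' π}

open Filter Topology

/-- The couplings of two Borel probability measures on Polish spaces form a compact set for the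
topology of convergence in distribution. -/
theorem isCompact_setOf_isCoupling
    {M M' : Type*} [TopologicalSpace M] [PolishSpace M] [MeasurableSpace M] [BorelSpace M]
    [TopologicalSpace M'] [PolishSpace M'] [MeasurableSpace M'] [BorelSpace M']
    (m : Measure M) [IsProbabilityMeasure m] (m' : Measure M') [IsProbabilityMeasure m'] :
    IsCompact {π : ProbabilityMeasure (M × M') | IsCoupling (π : Measure (M × M')) m m'} := by
  set S := {π : ProbabilityMeasure (M × M') | IsCoupling (π : Measure (M × M')) m m'}
  have hclosed : IsClosed S := by
    let μ : ProbabilityMeasure M := ⟨m, inferInstance⟩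
    let μ' : ProbabilityMeasure M' := ⟨m', inferInstance⟩
    have hS_eq : S = {π | π.map measurable_fst.aemeasurable = μ} ∩
        {π | π.map measurable_snd.aemeasurable = μ'} := by
      ext π
      exact and_congr
        (ProbabilityMeasure.toMeasure_injective.eq_iff
          (a := π.map measurable_fst.aemeasurable) (b := μ))
        (ProbabilityMeasure.toMeasure_injective.eq_iff
          (a := π.map measurable_snd.aemeasurable) (b := μ'))
    rw [hS_eq]
    exact (isClosed_eq (ProbabilityMeasure.continuous_map continuous_fst) continuous_const).inter
      (isClosed_eq (ProbabilityMeasure.continuous_map continuous_snd) continuous_const)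
  rw [← hclosed.closure_eq]
  refine isCompact_closure_of_isTightMeasureSet (IsTightMeasureSet.prodMk ?_ ?_)
  · refine (isTightMeasureSet_singleton (μ := m)).subset ?_
    rintro _ ⟨_, ⟨π, hπ, rfl⟩, rfl⟩
    exact hπ.1
  · refine (isTightMeasureSet_singleton (μ := m')).subset ?_
    rintro _ ⟨_, ⟨π, hπ, rfl⟩, rfl⟩
    exact hπ.2

/-- If `πₙ → π` in distribution, `εₙ → ε` and `πₙ ⊗ πₙ (f > εₙ) ≤ εₙ` for all `n`, with `f` lower
semicontinuous, then `π ⊗ π (f > ε) ≤ ε`. -/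
theorem measure_prod_lt_le_of_tendsto
    {X : Type*} [TopologicalSpace X] [PolishSpace X] [MeasurableSpace X] [BorelSpace X]
    {f : X × X → ℝ} (hf : LowerSemicontinuous f)
    {πs : ℕ → ProbabilityMeasure X} {π : ProbabilityMeasure X} (hπ : Tendsto πs atTop (𝓝 π))
    {εs : ℕ → ℝ} {ε : ℝ} (hε : Tendsto εs atTop (𝓝 ε))
    (h : ∀ n, ((πs n : Measure X).prod (πs n : Measure X)) {q | εs n < f q}
      ≤ ENNReal.ofReal (εs n)) :
    ((π : Measure X).prod (π : Measure X)) {q | ε < f q} ≤ ENNReal.ofReal ε := by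
  have hprod : Tendsto (fun n => (πs n).prod (πs n)) atTop (𝓝 (π.prod π)) :=
    (ProbabilityMeasure.continuous_prod.tendsto (π, π)).comp (hπ.prodMk_nhds hπ)
  have hlt : ∀ δ, ε < δ →
      ((π : Measure X).prod (π : Measure X)) {q | δ < f q} ≤ ENNReal.ofReal ε := by
    intro δ hδ
    calc ((π : Measure X).prod (π : Measure X)) {q | δ < f q}
        ≤ liminf (fun n => ((πs n).prod (πs n) : Measure (X × X)) {q | δ < f q}) atTop :=
          ProbabilityMeasure.le_liminf_measure_open_of_tendsto hprod (hf.isOpen_preimage δ)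
      _ ≤ liminf (fun n => ENNReal.ofReal (εs n)) atTop := by
          refine liminf_le_liminf ?_
          filter_upwards [hε.eventually_lt_const hδ] with n hn
          exact (measure_mono fun q (hq : δ < f q) => hn.trans hq).trans (h n)
      _ = ENNReal.ofReal ε := (ENNReal.tendsto_ofReal hε).liminf_eq
  obtain ⟨u, hu_anti, hu_gt, hu_lim⟩ := exists_seq_strictAnti_tendsto ε
  have hunion : {q | ε < f q} = ⋃ n, {q | u n < f q} := by
    ext q
    simp only [Set.mem_ofPred_eq, Set.mem_iUnion]
    exact ⟨fun hq => (hu_lim.eventually_lt_const hq).exists,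
      fun ⟨n, hn⟩ => (hu_gt n).trans hn⟩
  have hmono : Monotone fun n => {q | u n < f q} :=
    fun _ _ hab _ hq => (hu_anti.antitone hab).trans_lt hq
  rw [hunion, hmono.measure_iUnion]
  exact iSup_le fun n => hlt _ (hu_gt n)

/-- Existence of optimal couplings for the L⁰-distortion distance: there is a
coupling π of m and m' attaining the infimum defining LΔ₀, and moreover
π⊗π(|τ(x,y) − τ'(x',y')| > LΔ₀) ≤ LΔ₀. -/
theorem exists_optimal_coupling_LDelta0
    {M M' : Type*} [TopologicalSpace M] [PolishSpace M] [MeasurableSpace M] [BorelSpace M]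
    [TopologicalSpace M'] [PolishSpace M'] [MeasurableSpace M'] [BorelSpace M']
    (tau : M → M → ℝ) (tau' : M' → M' → ℝ)
    (htau : IsBLMS tau) (htau' : IsBLMS tau')
    (m : Measure M) [IsProbabilityMeasure m]
    (m' : Measure M') [IsProbabilityMeasure m'] :
    ∃ π : Measure (M × M'), IsCoupling π m m' ∧
      LDelta0 tau tau' m m' = sInf (distortionThresholds tau tau' π) ∧
      (π.prod π) {q : (M × M') × (M × M') |
          LDelta0 tau tau' m m' < |tau q.1.1 q.2.1 - tau' q.1.2 q.2.2|}
        ≤ ENNReal.ofReal (LDelta0 tau tau' m m') := by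
  set L := LDelta0 tau tau' m m'
  set S : Set ℝ := {ε : ℝ | ∃ π : Measure (M × M'), IsCoupling π m m' ∧
    ε ∈ distortionThresholds tau tau' π}
  have hS_nonneg : ∀ ε ∈ S, 0 ≤ ε := fun ε ⟨_, _, hε, _⟩ => hε.le
  have hS_bdd : BddBelow S := ⟨0, hS_nonneg⟩
  have hS_nonempty : S.Nonempty :=
    ⟨1, m.prod m', ⟨by simp, by simp⟩, one_pos, by simpa using prob_le_one⟩
  have hL_nonneg : 0 ≤ L := Real.sInf_nonneg hS_nonneg
  obtain ⟨ε, -, hε_lim, hε_mem⟩ := exists_seq_tendsto_sInf hS_nonempty hS_bdd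
  choose ρ hρ hρε using hε_mem
  have hρ_prob : ∀ n, IsProbabilityMeasure (ρ n) := fun n => by
    have : IsProbabilityMeasure ((ρ n).map Prod.fst) := by rw [(hρ n).1]; infer_instance
    exact Measure.isProbabilityMeasure_of_map Prod.fst
  let πs : ℕ → ProbabilityMeasure (M × M') := fun n => ⟨ρ n, hρ_prob n⟩
  obtain ⟨π, hπ, φ, hφ, hφ_lim⟩ :=
    (isCompact_setOf_isCoupling m m').tendsto_subseq (x := πs) hρ
  have hcont : Continuous fun q : (M × M') × (M × M') =>
      |tau q.1.1 q.2.1 - tau' q.1.2 q.2.2| :=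
    ((htau.continuous.comp (by fun_prop : Continuous fun q : (M × M') × (M × M') =>
        (q.1.1, q.2.1))).sub
      (htau'.continuous.comp (by fun_prop : Continuous fun q : (M × M') × (M × M') =>
        (q.1.2, q.2.2)))).abs
  have hbound := measure_prod_lt_le_of_tendsto hcont.lowerSemicontinuous hφ_lim
    (hε_lim.comp hφ.tendsto_atTop) fun n => (hρε (φ n)).2
  have hthresholds : ∀ δ, L < δ → δ ∈ distortionThresholds tau tau' (π : Measure (M × M')) :=
    fun δ hδ => ⟨hL_nonneg.trans_lt hδ,
      (measure_mono fun q (hq : δ < _) => hδ.trans hq).trans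
        (hbound.trans (ENNReal.ofReal_le_ofReal hδ.le))⟩
  refine ⟨π, hπ, le_antisymm ?_ ?_, hbound⟩
  · exact csInf_le_csInf hS_bdd ⟨L + 1, hthresholds _ (lt_add_one L)⟩ fun δ hδ => ⟨π, hπ, hδ⟩
  · exact le_of_forall_gt_imp_ge_of_dense fun δ hδ =>
      csInf_le ⟨0, fun _ h => h.1.le⟩ (hthresholds δ hδ)
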